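/- arXiv:0710.1598 — 2 statements merged into one kernel-verified Lean document; each statement's English description precedes it below -/
import Mathlib

section
/- Let N ≥ 4 and fix a null frame (ℓ, n, m_2, …, m_{N−1}) of ℝ^N. Say a Weyl tensor has pure boost weight b if all of its frame components of boost weight different from b vanish. Then the space of Weyl tensors on ℝ^N is the direct sum of its pure boost weight subspaces for b = 2, 1, 0, −1, −2, and their dimensions are: N(N−3)/2 for each of b = 2 and b = −2; (N−1)(N−2)(N−3)/3 for each of b = 1 and b = −1; and (N−2)²((N−2)²−1)/12 + (N−2)(N−3)/2 for b = 0. -/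
/-- The Minkowski symmetric bilinear form of signature `(-,+,…,+)` on `ℝ^N`. -/
def eta {N : ℕ} (x y : Fin N → ℝ) : ℝ :=
  ∑ a : Fin N, (if (a : ℕ) = 0 then -(x a * y a) else x a * y a)

/-- A null frame `(ℓ, n, m_2, …, m_{N-1})` of `ℝ^N`: a basis consisting of two null
vectors `ℓ = f 0`, `n = f 1` with `η(ℓ,n) = 1` and spacelike vectors `m_i = f i`
(`2 ≤ i`) orthonormal and orthogonal to `ℓ` and `n`. -/
def IsNullFrame {N : ℕ} [NeZero N] (f : Fin N → Fin N → ℝ) : Prop :=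
  LinearIndependent ℝ f ∧
  eta (f 0) (f 0) = 0 ∧ eta (f 1) (f 1) = 0 ∧ eta (f 0) (f 1) = 1 ∧
  (∀ i j : Fin N, 2 ≤ (i : ℕ) → 2 ≤ (j : ℕ) →
      eta (f i) (f j) = if i = j then 1 else 0) ∧
  (∀ i : Fin N, 2 ≤ (i : ℕ) → eta (f 0) (f i) = 0 ∧ eta (f 1) (f i) = 0)

/-- Boost weight of a frame index: `b_0 = 1`, `b_1 = -1`, `b_i = 0` for spatial `i`. -/
def bw {N : ℕ} (A : Fin N) : ℤ :=
  if (A : ℕ) = 0 then 1 else if (A : ℕ) = 1 then -1 else 0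

/-- A Weyl tensor on `ℝ^N`: a 4-linear form with the pair symmetries
`W(x,y,z,w) = -W(y,x,z,w) = W(z,w,x,y)`, the first Bianchi identity, and all
`η`-traces zero (the standard basis being `η`-orthonormal, the `η`-trace of
`(u,v) ↦ W(u,x,v,y)` is `∑ₐ η^{aa} W(eₐ,x,eₐ,y)` with `η^{00} = -1`, `η^{aa} = 1`). -/
def IsWeyl {N : ℕ} (W : MultilinearMap ℝ (fun _ : Fin 4 => (Fin N → ℝ)) ℝ) : Prop :=
  (∀ x y z w : Fin N → ℝ, W ![y, x, z, w] = - W ![x, y, z, w]) ∧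
  (∀ x y z w : Fin N → ℝ, W ![z, w, x, y] = W ![x, y, z, w]) ∧
  (∀ x y z w : Fin N → ℝ,
    W ![x, y, z, w] + W ![x, z, w, y] + W ![x, w, y, z] = 0) ∧
  (∀ x y : Fin N → ℝ,
    ∑ a : Fin N, (if (a : ℕ) = 0 then (-1 : ℝ) else 1) *
      W ![Pi.single a 1, x, Pi.single a 1, y] = 0)

/-- The real vector space of Weyl tensors on `ℝ^N`, as a submodule of the space of
4-linear forms. -/
noncomputable def weylSubmodule (N : ℕ) :
    Submodule ℝ (MultilinearMap ℝ (fun _ : Fin 4 => (Fin N → ℝ)) ℝ) where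
  carrier := {W | IsWeyl W}
  add_mem' := by
    rintro W V ⟨w1, w2, w3, w4⟩ ⟨v1, v2, v3, v4⟩
    refine ⟨fun x y z w => ?_, fun x y z w => ?_, fun x y z w => ?_, fun x y => ?_⟩
    · simp only [MultilinearMap.add_apply]
      rw [w1 x y z w, v1 x y z w]; ring
    · simp only [MultilinearMap.add_apply]
      rw [w2 x y z w, v2 x y z w]
    · simp only [MultilinearMap.add_apply]
      have h1 := w3 x y z w; have h2 := v3 x y z w; linarith
    · simp only [MultilinearMap.add_apply, mul_add, Finset.sum_add_distrib]
      rw [w4 x y, v4 x y]; ring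
  zero_mem' := by
    refine ⟨fun x y z w => ?_, fun x y z w => ?_, fun x y z w => ?_, fun x y => ?_⟩ <;>
      simp
  smul_mem' := by
    rintro c W ⟨w1, w2, w3, w4⟩
    refine ⟨fun x y z w => ?_, fun x y z w => ?_, fun x y z w => ?_, fun x y => ?_⟩
    · simp only [MultilinearMap.smul_apply, smul_eq_mul]
      rw [w1 x y z w]; ring
    · simp only [MultilinearMap.smul_apply, smul_eq_mul]
      rw [w2 x y z w]
    · simp only [MultilinearMap.smul_apply, smul_eq_mul]
      have h1 := w3 x y z w; linear_combination c * h1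
    · simp only [MultilinearMap.smul_apply, smul_eq_mul]
      have h : ∀ a : Fin N,
          (if (a : ℕ) = 0 then (-1 : ℝ) else 1) *
              (c * W ![Pi.single a 1, x, Pi.single a 1, y])
            = c * ((if (a : ℕ) = 0 then (-1 : ℝ) else 1) *
              W ![Pi.single a 1, x, Pi.single a 1, y]) := fun a => by ring
      simp_rw [h]
      rw [← Finset.mul_sum, w4 x y, mul_zero]

/-- The subspace of Weyl tensors of pure boost weight `b` with respect to the frame
`f`: all frame components of boost weight different from `b` vanish. -/
noncomputable def weylPure (N : ℕ) (f : Fin N → Fin N → ℝ) (b : ℤ) :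
    Submodule ℝ (weylSubmodule N) where
  carrier := {W | ∀ A : Fin 4 → Fin N, (∑ k, bw (A k)) ≠ b →
    W.val (fun k => f (A k)) = 0}
  add_mem' := by
    intro W V hW hV A hA
    simp only [Submodule.coe_add, MultilinearMap.add_apply, hW A hA, hV A hA, add_zero]
  zero_mem' := by
    intro A hA
    simp
  smul_mem' := by
    intro c W hW A hA
    simp only [Submodule.coe_smul, MultilinearMap.smul_apply, hW A hA, smul_zero]


/-- Arrays with the symmetries of a curvature tensor whose only nonzero entries have total
weight `β`, where the index `a` has weight `w a`. -/
def curvatureArrays {ι : Type*} (w : ι → ℤ) (β : ℤ) :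
    Submodule ℝ (ι × ι × ι × ι → ℝ) where
  carrier := {T |
    (∀ a b c d, T (b, a, c, d) = -T (a, b, c, d)) ∧
    (∀ a b c d, T (c, d, a, b) = T (a, b, c, d)) ∧
    (∀ a b c d, T (a, b, c, d) + T (a, c, d, b) + T (a, d, b, c) = 0) ∧
    ∀ a b c d, w a + w b + w c + w d ≠ β → T (a, b, c, d) = 0}
  add_mem' := by
    rintro S T ⟨s1, s2, s3, s4⟩ ⟨t1, t2, t3, t4⟩
    refine ⟨fun a b c d => ?_, fun a b c d => ?_, fun a b c d => ?_, fun a b c d h => ?_⟩ <;>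
      simp only [Pi.add_apply]
    · rw [s1, t1, neg_add]
    · rw [s2, t2]
    · linear_combination s3 a b c d + t3 a b c d
    · rw [s4 a b c d h, t4 a b c d h, add_zero]
  zero_mem' := by simp
  smul_mem' := by
    rintro r T ⟨t1, t2, t3, t4⟩
    refine ⟨fun a b c d => ?_, fun a b c d => ?_, fun a b c d => ?_, fun a b c d h => ?_⟩ <;>
      simp only [Pi.smul_apply, smul_eq_mul]
    · rw [t1, mul_neg]
    · rw [t2]
    · linear_combination r * t3 a b c d
    · rw [t4 a b c d h, mul_zero]

/-- Symmetric arrays with two indices whose only nonzero entries have total weight `β`. -/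
def symmetricArrays {ι : Type*} (w : ι → ℤ) (β : ℤ) : Submodule ℝ (ι × ι → ℝ) where
  carrier := {h | (∀ a b, h (b, a) = h (a, b)) ∧ ∀ a b, w a + w b ≠ β → h (a, b) = 0}
  add_mem' := by
    rintro g h ⟨g1, g2⟩ ⟨h1, h2⟩
    refine ⟨fun a b => ?_, fun a b hab => ?_⟩ <;> simp only [Pi.add_apply]
    · rw [g1, h1]
    · rw [g2 a b hab, h2 a b hab, add_zero]
  zero_mem' := by simp
  smul_mem' := by
    rintro r h ⟨h1, h2⟩
    refine ⟨fun a b => ?_, fun a b hab => ?_⟩ <;> simp only [Pi.smul_apply, smul_eq_mul]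
    · rw [h1]
    · rw [h2 a b hab, mul_zero]

/-- The contraction of the first and third indices with respect to the metric whose nonzero
entries are `g (a, s a) = 1`. -/
def ricciContraction {ι : Type*} [Fintype ι] (s : ι → ι) :
    (ι × ι × ι × ι → ℝ) →ₗ[ℝ] (ι × ι → ℝ) where
  toFun T p := ∑ a, T (a, p.1, s a, p.2)
  map_add' S T := by ext p; simp [Finset.sum_add_distrib]
  map_smul' r T := by ext p; simp [Finset.mul_sum]

/-- The trace-free curvature arrays of weight `β`. -/
def weylArrays {ι : Type*} [Fintype ι] (s : ι → ι) (w : ι → ℤ) (β : ℤ) :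
    Submodule ℝ (ι × ι × ι × ι → ℝ) :=
  curvatureArrays w β ⊓ LinearMap.ker (ricciContraction s)

section Contraction

variable {ι : Type*} [Fintype ι] {s : ι → ι} {w : ι → ℤ}

theorem ricciContraction_mem (hs : s.Involutive) (hw : ∀ a, w (s a) = -w a) {β : ℤ}
    {T : ι × ι × ι × ι → ℝ} (hT : T ∈ curvatureArrays w β) :
    ricciContraction s T ∈ symmetricArrays w β := by
  obtain ⟨-, t2, -, t4⟩ := hT
  refine ⟨fun a b => ?_, fun a b hab => ?_⟩
  · change ∑ c, T (c, b, s c, a) = ∑ c, T (c, a, s c, b)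
    rw [← hs.bijective.sum_comp]
    exact Finset.sum_congr rfl fun c _ => by rw [hs c, t2]
  · refine Finset.sum_eq_zero fun c _ => t4 _ _ _ _ ?_
    rw [hw]
    intro h
    exact hab (by simpa using by linarith)

variable [DecidableEq ι]

/-- The Kulkarni–Nomizu product of an array with the metric `g (a, s a) = 1`. -/
def kulkarniNomizu (s : ι → ι) (h : ι × ι → ℝ) : ι × ι × ι × ι → ℝ := fun p =>
  h (p.1, p.2.2.1) * (if p.2.1 = s p.2.2.2 then 1 else 0)
    + (if p.1 = s p.2.2.1 then 1 else 0) * h (p.2.1, p.2.2.2)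
    - h (p.1, p.2.2.2) * (if p.2.1 = s p.2.2.1 then 1 else 0)
    - (if p.1 = s p.2.2.2 then 1 else 0) * h (p.2.1, p.2.2.1)

omit [Fintype ι] in
theorem kulkarniNomizu_mem (hs : s.Involutive) (hw : ∀ a, w (s a) = -w a) {β : ℤ}
    {h : ι × ι → ℝ} (hh : h ∈ symmetricArrays w β) :
    kulkarniNomizu s h ∈ curvatureArrays w β := by
  obtain ⟨h1, h2⟩ := hh
  have hg (a b : ι) : (if a = s b then (1 : ℝ) else 0) = if b = s a then 1 else 0 :=
    if_congr (eq_comm.trans hs.eq_iff) rfl rfl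
  have hz (a b c d : ι) (hne : w a + w b + w c + w d ≠ β) :
      h (a, b) * (if c = s d then 1 else 0) = 0 := by
    by_cases e : c = s d
    · rw [h2, zero_mul]
      intro hab
      apply hne
      rw [e, hw]
      omega
    · rw [if_neg e, mul_zero]
  refine ⟨fun a b c d => ?_, fun a b c d => ?_, fun a b c d => ?_, fun a b c d hne => ?_⟩ <;>
    simp only [kulkarniNomizu]
  · ring
  · rw [h1 a c, h1 b d, h1 a d, h1 b c, hg d b, hg c a, hg d a, hg c b]
    ring
  · rw [h1 b c, h1 b d, h1 c d, hg d b, hg c b, hg d c]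
    ring
  · rw [hz a c b d (by omega), hz a d b c (by omega), mul_comm, hz b d a c (by omega), mul_comm,
      hz b c a d (by omega)]
    ring

theorem ricciContraction_kulkarniNomizu (hs : s.Involutive) (h : ι × ι → ℝ)
    (a b : ι) :
    ricciContraction s (kulkarniNomizu s h) (a, b) =
      (Fintype.card ι - 2) * h (a, b) + (∑ c, h (c, s c)) * (if a = s b then 1 else 0) := by
  have e (c : ι) : (a = s (s c)) = (a = c) := by rw [hs]
  have e' (c : ι) : (c = s (s c)) = True := by rw [hs]; simp
  simp only [ricciContraction, kulkarniNomizu, LinearMap.coe_mk, AddHom.coe_mk, e, e']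
  simp only [Finset.sum_sub_distrib, Finset.sum_add_distrib, mul_ite, ite_mul, mul_one, mul_zero,
    one_mul, zero_mul, if_true, Finset.sum_ite_eq, Finset.sum_ite_eq', Finset.mem_univ, hs b]
  split_ifs <;> simp <;> ring

theorem map_ricciContraction (hs : s.Involutive) (hw : ∀ a, w (s a) = -w a)
    (hι : 3 ≤ Fintype.card ι) (β : ℤ) :
    (curvatureArrays w β).map (ricciContraction s) = symmetricArrays w β := by
  apply le_antisymm
  · rintro _ ⟨T, hT, rfl⟩
    exact ricciContraction_mem hs hw hT
  intro h hh
  have hc : (3 : ℝ) ≤ Fintype.card ι := by exact_mod_cast hι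
  have hc2 : (Fintype.card ι : ℝ) - 2 ≠ 0 := by linarith
  have hc1 : (Fintype.card ι : ℝ) - 1 ≠ 0 := by linarith
  set t : ℝ := ∑ c, h (c, s c) with ht
  set r : ℝ := t / (2 * (Fintype.card ι - 1)) with hr
  let g : ι × ι → ℝ := fun p => if p.1 = s p.2 then 1 else 0
  have hrg : r • g ∈ symmetricArrays w β := by
    by_cases hβ : β = 0
    · refine Submodule.smul_mem _ _ ⟨fun a b => if_congr ?_ rfl rfl, fun a b hab => if_neg ?_⟩
      · exact eq_comm.trans hs.eq_iff
      · rintro (rfl : a = s b)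
        exact hab (by rw [hw, hβ]; ring)
    · have : t = 0 := Finset.sum_eq_zero fun c _ => hh.2 _ _ (by rw [hw]; omega)
      rw [hr, this, zero_div, zero_smul]
      exact Submodule.zero_mem _
  have hk : ((Fintype.card ι : ℝ) - 2)⁻¹ • (h - r • g) ∈ symmetricArrays w β :=
    Submodule.smul_mem _ _ (Submodule.sub_mem _ hh hrg)
  refine ⟨_, kulkarniNomizu_mem hs hw hk, ?_⟩
  ext ⟨a, b⟩
  have hg (c : ι) : (if c = s (s c) then (1 : ℝ) else 0) = 1 := if_pos (hs c).symm
  rw [ricciContraction_kulkarniNomizu hs]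
  simp only [Pi.smul_apply, Pi.sub_apply, smul_eq_mul, g, hg, ← Finset.mul_sum,
    Finset.sum_sub_distrib, ← ht, Finset.sum_const, Finset.card_univ, nsmul_eq_mul]
  rw [hr]
  field_simp
  ring

theorem finrank_weylArrays_add (hs : s.Involutive) (hw : ∀ a, w (s a) = -w a)
    (hι : 3 ≤ Fintype.card ι) (β : ℤ) :
    Module.finrank ℝ (weylArrays s w β) + Module.finrank ℝ (symmetricArrays w β) =
      Module.finrank ℝ (curvatureArrays w β) := by
  rw [← map_ricciContraction hs hw hι β, ← LinearMap.finrank_range_add_finrank_ker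
    ((ricciContraction s).domRestrict (curvatureArrays w β)), LinearMap.range_domRestrict,
    LinearMap.ker_domRestrict, add_comm, weylArrays]
  congr 1
  rw [← Submodule.map_comap_subtype,
    (Submodule.equivMapOfInjective _ (Submodule.subtype_injective _) _).finrank_eq]

end Contraction

section Dimension

theorem trace_pi {κ : Type*} [Fintype κ] [DecidableEq κ] (P : (κ → ℝ) →ₗ[ℝ] κ → ℝ) :
    LinearMap.trace ℝ (κ → ℝ) P = ∑ p, P (Pi.single p 1) p := by
  rw [LinearMap.trace_eq_matrix_trace ℝ (Pi.basisFun ℝ κ), Matrix.trace]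
  exact Finset.sum_congr rfl fun p _ => by simp

/-- The signed sum of an array over the symmetries of an index square generated by the two
pair reflections and the exchange of pairs. -/
def pairSymmetrization {ι : Type*} (T : ι × ι × ι × ι → ℝ) (a b c d : ι) : ℝ :=
  T (a, b, c, d) - T (b, a, c, d) - T (a, b, d, c) + T (b, a, d, c)
    + T (c, d, a, b) - T (d, c, a, b) - T (c, d, b, a) + T (d, c, b, a)

/-- The Young projection onto the curvature arrays of weight `β`. -/
noncomputable def curvatureProjection {ι : Type*} (w : ι → ℤ) (β : ℤ) :
    (ι × ι × ι × ι → ℝ) →ₗ[ℝ] ι × ι × ι × ι → ℝ where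
  toFun T := fun (a, b, c, d) =>
    (if w a + w b + w c + w d = β then 1 else 0) *
      ((2 * pairSymmetrization T a b c d - pairSymmetrization T a c d b
        - pairSymmetrization T a d b c) / 24)
  map_add' S T := by
    ext ⟨a, b, c, d⟩
    simp only [pairSymmetrization, Pi.add_apply]
    ring
  map_smul' r T := by
    ext ⟨a, b, c, d⟩
    simp only [pairSymmetrization, Pi.smul_apply, smul_eq_mul, RingHom.id_apply]
    ring

theorem isProj_curvatureProjection {ι : Type*} (w : ι → ℤ) (β : ℤ) :
    LinearMap.IsProj (curvatureArrays w β) (curvatureProjection w β) := by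
  refine ⟨fun T => ⟨fun a b c d => ?_, fun a b c d => ?_, fun a b c d => ?_,
    fun a b c d h => ?_⟩, ?_⟩
  · simp only [curvatureProjection, pairSymmetrization, LinearMap.coe_mk, AddHom.coe_mk,
      add_comm (w b) (w a)]
    ring
  · have : w c + w d + w a + w b = w a + w b + w c + w d := by ring
    simp only [curvatureProjection, pairSymmetrization, LinearMap.coe_mk, AddHom.coe_mk, this]
    ring
  · have h1 : w a + w c + w d + w b = w a + w b + w c + w d := by ring
    have h2 : w a + w d + w b + w c = w a + w b + w c + w d := by ring
    simp only [curvatureProjection, pairSymmetrization, LinearMap.coe_mk, AddHom.coe_mk, h1, h2]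
    ring
  · simp [curvatureProjection, h]
  · rintro T ⟨t1, t2, t3, t4⟩
    have t5 (a b c d : ι) : T (a, b, d, c) = -T (a, b, c, d) := by rw [← t2, t1, t2]
    have hS (a b c d : ι) : pairSymmetrization T a b c d = 8 * T (a, b, c, d) := by
      rw [pairSymmetrization, t1 a b d c, t1 c d b a, t5 c d a b, t1 c d a b, t1 a b c d,
        t5 a b c d, t2 a b c d]
      ring
    ext ⟨a, b, c, d⟩
    simp only [curvatureProjection, LinearMap.coe_mk, AddHom.coe_mk, hS]
    split_ifs with h
    · linear_combination (-1 / 3) * t3 a b c d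
    · rw [t4 a b c d h, zero_mul]

/-- The projection onto the symmetric arrays of weight `β`. -/
noncomputable def symmetricProjection {ι : Type*} (w : ι → ℤ) (β : ℤ) :
    (ι × ι → ℝ) →ₗ[ℝ] ι × ι → ℝ where
  toFun h := fun (a, b) => (if w a + w b = β then 1 else 0) * ((h (a, b) + h (b, a)) / 2)
  map_add' g h := by
    ext ⟨a, b⟩
    simp only [Pi.add_apply]
    ring
  map_smul' r h := by
    ext ⟨a, b⟩
    simp only [Pi.smul_apply, smul_eq_mul, RingHom.id_apply]
    ring

theorem isProj_symmetricProjection {ι : Type*} (w : ι → ℤ) (β : ℤ) :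
    LinearMap.IsProj (symmetricArrays w β) (symmetricProjection w β) := by
  refine ⟨fun h => ⟨fun a b => ?_, fun a b hab => ?_⟩, ?_⟩
  · simp only [symmetricProjection, LinearMap.coe_mk, AddHom.coe_mk, add_comm (w b) (w a),
      add_comm (h (b, a))]
  · simp [symmetricProjection, hab]
  · rintro h ⟨h1, h2⟩
    ext ⟨a, b⟩
    simp only [symmetricProjection, LinearMap.coe_mk, AddHom.coe_mk, h1 a b]
    split_ifs with hab
    · ring
    · rw [h2 a b hab, zero_mul]

theorem sum_fin_add_two {n : ℕ} (g : Fin (n + 2) → ℝ) :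
    ∑ a, g a = g 0 + g 1 + ∑ i : Fin n, g i.succ.succ := by
  rw [Fin.sum_univ_succ, Fin.sum_univ_succ]
  exact (add_assoc _ _ _).symm

@[elab_as_elim]
theorem fin_add_two_cases {n : ℕ} {P : Fin (n + 2) → Prop} (zero : P 0) (one : P 1)
    (spatial : ∀ i : Fin n, P i.succ.succ) (A : Fin (n + 2)) : P A :=
  Fin.cases zero (Fin.cases one spatial) A

theorem bw_zero {n : ℕ} : bw (0 : Fin (n + 2)) = 1 := rfl

theorem bw_one {n : ℕ} : bw (1 : Fin (n + 2)) = -1 := rfl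

theorem bw_succ_succ {n : ℕ} (i : Fin n) : bw i.succ.succ = 0 := by simp [bw]

theorem finrank_symmetricArrays (n : ℕ) (β : ℤ) :
    (2 * Module.finrank ℝ (symmetricArrays (bw (N := n + 2)) β) : ℝ) =
      2 * ((if 2 = β then 1 else 0) + (if -2 = β then 1 else 0))
        + 2 * n * ((if 1 = β then 1 else 0) + (if -1 = β then 1 else 0))
        + (n ^ 2 + n + 2) * (if 0 = β then 1 else 0) := by
  rw [← (isProj_symmetricProjection _ _).trace, trace_pi]
  generalize hI : (fun k : ℤ => if k = β then (1 : ℝ) else 0) = I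
  have hI' (k : ℤ) : (if k = β then (1 : ℝ) else 0) = I k := congrFun hI k
  simp only [symmetricProjection, LinearMap.coe_mk, AddHom.coe_mk, hI']
  simp only [mul_div_assoc', ← Finset.sum_div, mul_add, Finset.sum_add_distrib]
  simp [Fintype.sum_prod_type, Pi.single_apply, ite_and]
  simp only [sum_fin_add_two, bw_zero, bw_one, bw_succ_succ, Finset.sum_const, Finset.card_univ,
    Fintype.card_fin, nsmul_eq_mul]
  norm_num
  ring

theorem finrank_curvatureArrays (n : ℕ) (β : ℤ) :
    (24 * Module.finrank ℝ (curvatureArrays (bw (N := n + 2)) β) : ℝ) =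
      (12 * n ^ 2 + 12 * n) * ((if 2 = β then 1 else 0) + (if -2 = β then 1 else 0))
        + (8 * n ^ 3 + 16 * n) * ((if 1 = β then 1 else 0) + (if -1 = β then 1 else 0))
        + (2 * n ^ 4 + 22 * n ^ 2 + 24) * (if 0 = β then 1 else 0) := by
  rw [← (isProj_curvatureProjection _ _).trace, trace_pi]
  generalize hI : (fun k : ℤ => if k = β then (1 : ℝ) else 0) = I
  have hI' (k : ℤ) : (if k = β then (1 : ℝ) else 0) = I k := congrFun hI k
  simp only [curvatureProjection, pairSymmetrization, LinearMap.coe_mk, AddHom.coe_mk, hI']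
  simp only [mul_div_assoc', ← Finset.sum_div, mul_sub, mul_add, Finset.sum_sub_distrib,
    Finset.sum_add_distrib, mul_left_comm _ (2 : ℝ), ← Finset.mul_sum]
  simp [Fintype.sum_prod_type, Pi.single_apply, ite_and]
  simp only [sum_fin_add_two, bw_zero, bw_one, bw_succ_succ, Finset.sum_const, Finset.card_univ,
    Fintype.card_fin, nsmul_eq_mul]
  norm_num
  ring

/-- The exchange of the two null indices. -/
def nullSwap {n : ℕ} : Fin (n + 2) → Fin (n + 2) := Equiv.swap 0 1

theorem nullSwap_involutive {n : ℕ} : (nullSwap (n := n)).Involutive := Equiv.swap_apply_self 0 1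

theorem bw_nullSwap {n : ℕ} (a : Fin (n + 2)) : bw (nullSwap a) = -bw a := by
  induction a using fin_add_two_cases with
  | zero => simp [nullSwap, bw_zero, bw_one]
  | one => simp [nullSwap, bw_zero, bw_one]
  | spatial i =>
    rw [nullSwap, Equiv.swap_apply_of_ne_of_ne (Fin.succ_ne_zero _) (by simp [Fin.ext_iff]),
      bw_succ_succ, neg_zero]

theorem finrank_weylArrays {n : ℕ} (hn : 1 ≤ n) (β : ℤ) :
    (12 * Module.finrank ℝ (weylArrays nullSwap (bw (N := n + 2)) β) : ℝ) =
      6 * (n + 2) * (n - 1) * ((if 2 = β then 1 else 0) + (if -2 = β then 1 else 0))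
        + 4 * (n + 1) * n * (n - 1) * ((if 1 = β then 1 else 0) + (if -1 = β then 1 else 0))
        + (n ^ 2 * (n ^ 2 - 1) + 6 * n * (n - 1)) * (if 0 = β then 1 else 0) := by
  have h := finrank_weylArrays_add (nullSwap_involutive (n := n)) bw_nullSwap
    (by rw [Fintype.card_fin]; omega) β
  have h' := congrArg (Nat.cast (R := ℝ)) h
  push_cast at h'
  linear_combination 12 * h' + (1 / 2) * finrank_curvatureArrays n β
    - 6 * finrank_symmetricArrays n β

end Dimension

section Frame

/-- A four-linear form is determined by its components in a basis, which are arbitrary. -/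
noncomputable def componentsEquiv {ι V : Type*} [Finite ι] [AddCommGroup V] [Module ℝ V]
    (B : Module.Basis ι ℝ V) :
    MultilinearMap ℝ (fun _ : Fin 4 => V) ℝ ≃ₗ[ℝ] (ι × ι × ι × ι → ℝ) :=
  LinearEquiv.ofBijective
    { toFun := fun W p => W ![B p.1, B p.2.1, B p.2.2.1, B p.2.2.2]
      map_add' := fun _ _ => rfl
      map_smul' := fun _ _ => rfl } <| by
    constructor
    · intro W V h
      refine Module.Basis.ext_multilinear (fun _ => B) fun v => ?_
      have hv : (fun i => B (v i)) = ![B (v 0), B (v 1), B (v 2), B (v 3)] := by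
        ext i; fin_cases i <;> rfl
      rw [hv]
      exact congrFun h (v 0, v 1, v 2, v 3)
    · intro T
      classical
      have := Fintype.ofFinite ι
      refine ⟨∑ p : ι × ι × ι × ι, T p • (MultilinearMap.mkPiAlgebra ℝ (Fin 4) ℝ).compLinearMap
        fun i => B.coord (![p.1, p.2.1, p.2.2.1, p.2.2.2] i), ?_⟩
      ext ⟨a, b, c, d⟩
      simp [Fin.prod_univ_four, Fintype.sum_prod_type, Finsupp.single_apply]

theorem componentsEquiv_apply {ι V : Type*} [Finite ι] [AddCommGroup V] [Module ℝ V]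
    (B : Module.Basis ι ℝ V) (W : MultilinearMap ℝ (fun _ : Fin 4 => V) ℝ) (a b c d : ι) :
    componentsEquiv B W (a, b, c, d) = W ![B a, B b, B c, B d] := rfl

theorem MultilinearMap.domDomCongr_vec_four {V : Type*} [AddCommGroup V] [Module ℝ V]
    (W : MultilinearMap ℝ (fun _ : Fin 4 => V) ℝ) (σ : Equiv.Perm (Fin 4)) (v : Fin 4 → V) :
    W.domDomCongr σ v = W ![v (σ 0), v (σ 1), v (σ 2), v (σ 3)] := by
  rw [MultilinearMap.domDomCongr_apply]
  congr 1
  ext i; fin_cases i <;> rfl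

theorem apply_eq_zero_of_basis {ι V : Type*} [Finite ι] [AddCommGroup V] [Module ℝ V]
    (B : Module.Basis ι ℝ V) {W : MultilinearMap ℝ (fun _ : Fin 4 => V) ℝ}
    (h : ∀ a b c d, W ![B a, B b, B c, B d] = 0) (v : Fin 4 → V) : W v = 0 := by
  have : W = 0 := (componentsEquiv B).injective <| by
    ext ⟨a, b, c, d⟩
    rw [componentsEquiv_apply, h, map_zero, Pi.zero_apply]
  rw [this, zero_apply]

/-- The bilinear form obtained from a four-linear form by fixing the second and fourth
arguments. -/
noncomputable def fixSecondFourth {V : Type*} [AddCommGroup V] [Module ℝ V]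
    (W : MultilinearMap ℝ (fun _ : Fin 4 => V) ℝ) (x y : V) : V →ₗ[ℝ] V →ₗ[ℝ] ℝ :=
  have h0 (u v z : V) : Function.update ![z, x, v, y] 0 u = ![u, x, v, y] := by
    ext i; fin_cases i <;> rfl
  have h2 (u v z : V) : Function.update ![u, x, z, y] 2 v = ![u, x, v, y] := by
    ext i; fin_cases i <;> rfl
  LinearMap.mk₂ ℝ (fun u v => W ![u, x, v, y])
    (fun u u' v => by simpa only [h0] using W.map_update_add ![0, x, v, y] 0 u u')
    (fun r u v => by simpa only [h0] using W.map_update_smul ![0, x, v, y] 0 r u)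
    (fun u v v' => by simpa only [h2] using W.map_update_add ![u, x, 0, y] 2 v v')
    (fun r u v => by simpa only [h2] using W.map_update_smul ![u, x, 0, y] 2 r v)

theorem fixSecondFourth_apply {V : Type*} [AddCommGroup V] [Module ℝ V]
    (W : MultilinearMap ℝ (fun _ : Fin 4 => V) ℝ) (x y u v : V) :
    fixSecondFourth W x y u v = W ![u, x, v, y] := rfl

theorem eta_comm {N : ℕ} (x y : Fin N → ℝ) : eta x y = eta y x := by
  simp only [eta, mul_comm]

variable {n : ℕ} {f : Fin (n + 2) → Fin (n + 2) → ℝ}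

theorem IsNullFrame.eta_eq (hf : IsNullFrame f) (A B : Fin (n + 2)) :
    eta (f A) (f B) = if B = nullSwap A then 1 else 0 := by
  obtain ⟨-, h00, h11, h01, hij, h0i⟩ := hf
  have hs (i : Fin n) : nullSwap i.succ.succ = i.succ.succ :=
    Equiv.swap_apply_of_ne_of_ne (Fin.succ_ne_zero _) (by simp [Fin.ext_iff])
  have s0 : nullSwap (0 : Fin (n + 2)) = 1 := Equiv.swap_apply_left 0 1
  have s1 : nullSwap (1 : Fin (n + 2)) = 0 := Equiv.swap_apply_right 0 1
  have h2 (i : Fin n) : 2 ≤ (i.succ.succ : ℕ) := by simp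
  have hne (i : Fin n) : (i.succ.succ : Fin (n + 2)) ≠ 1 := by simp [Fin.ext_iff]
  have hne' (i : Fin n) : (1 : Fin (n + 2)) ≠ i.succ.succ := (hne i).symm
  induction A using fin_add_two_cases with
  | zero =>
    induction B using fin_add_two_cases with
    | zero => simp [h00, s0]
    | one => simp [h01, s0]
    | spatial j => simp [(h0i _ (h2 j)).1, s0, hne]
  | one =>
    induction B using fin_add_two_cases with
    | zero => simp [eta_comm, h01, s1]
    | one => simp [h11, s1]
    | spatial j => simp [(h0i _ (h2 j)).2, s1]
  | spatial i =>
    induction B using fin_add_two_cases with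
    | zero => simp [eta_comm _ (f 0), (h0i _ (h2 i)).1, hs, (Fin.succ_ne_zero _).symm]
    | one => simp [eta_comm _ (f 1), (h0i _ (h2 i)).2, hs, hne']
    | spatial j =>
      rw [hij _ _ (h2 i) (h2 j), hs]
      exact if_congr eq_comm rfl rfl

theorem IsNullFrame.sum_mul (hf : IsNullFrame f) (a b : Fin (n + 2)) :
    ∑ A, f A a * f (nullSwap A) b = if a = b then (if (a : ℕ) = 0 then -1 else 1) else 0 := by
  let F : Matrix (Fin (n + 2)) (Fin (n + 2)) ℝ := Matrix.of f
  let G : Matrix (Fin (n + 2)) (Fin (n + 2)) ℝ :=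
    Matrix.of fun a A => (if (a : ℕ) = 0 then -1 else 1) * f (nullSwap A) a
  have hFG : F * G = 1 := by
    ext A B
    rw [Matrix.mul_apply, Matrix.one_apply]
    trans eta (f A) (f (nullSwap B))
    · refine Finset.sum_congr rfl fun a _ => ?_
      simp only [F, G, Matrix.of_apply]
      split_ifs <;> ring
    · rw [hf.eta_eq]
      exact if_congr (nullSwap_involutive.injective.eq_iff.trans eq_comm) rfl rfl
  have hGF : (G * F) b a = (1 : Matrix _ _ ℝ) b a := by rw [mul_eq_one_comm.mp hFG]
  rw [Matrix.mul_apply, Matrix.one_apply] at hGF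
  simp only [F, G, Matrix.of_apply, mul_assoc, ← Finset.mul_sum] at hGF
  simp only [mul_comm (f _ a)]
  by_cases hab : a = b
  · subst hab
    split_ifs at hGF ⊢ <;> simp_all <;> linarith
  · rw [if_neg hab]
    rw [if_neg (Ne.symm hab)] at hGF
    split_ifs at hGF <;> linarith

theorem IsNullFrame.sum_bilin (hf : IsNullFrame f)
    (L : (Fin (n + 2) → ℝ) →ₗ[ℝ] (Fin (n + 2) → ℝ) →ₗ[ℝ] ℝ) :
    ∑ a : Fin (n + 2), (if (a : ℕ) = 0 then (-1 : ℝ) else 1) *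
        L (Pi.single a 1) (Pi.single a 1) = ∑ A, L (f A) (f (nullSwap A)) := by
  have hexp (A B : Fin (n + 2)) : L (f A) (f B) =
      ∑ a, ∑ b, f A a * f B b * L (Pi.single a 1) (Pi.single b 1) := by
    have h (v : Fin (n + 2) → ℝ) : v = ∑ a, v a • Pi.single a (1 : ℝ) := by
      simpa using (Pi.basisFun ℝ (Fin (n + 2))).sum_repr v |>.symm
    conv_lhs => rw [h (f A), h (f B)]
    simp only [map_sum, map_smul, LinearMap.sum_apply, LinearMap.smul_apply, smul_eq_mul,
      Finset.mul_sum]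
    rw [Finset.sum_comm]
    exact Finset.sum_congr rfl fun _ _ => Finset.sum_congr rfl fun _ _ => by ring
  simp only [hexp]
  rw [Finset.sum_comm]
  refine Finset.sum_congr rfl fun a _ => ?_
  rw [Finset.sum_comm]
  simp only [← Finset.sum_mul, hf.sum_mul]
  simp

/-- The basis of a null frame. -/
noncomputable def IsNullFrame.basis (hf : IsNullFrame f) :
    Module.Basis (Fin (n + 2)) ℝ (Fin (n + 2) → ℝ) :=
  basisOfLinearIndependentOfCardEqFinrank hf.1 (by simp)

theorem IsNullFrame.basis_apply (hf : IsNullFrame f) (A : Fin (n + 2)) : hf.basis A = f A := by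
  simp [IsNullFrame.basis]

theorem IsNullFrame.isWeyl_iff (hf : IsNullFrame f)
    (W : MultilinearMap ℝ (fun _ : Fin 4 => (Fin (n + 2) → ℝ)) ℝ) :
    IsWeyl W ↔
      (∀ a b c d, componentsEquiv hf.basis W (b, a, c, d) =
        -componentsEquiv hf.basis W (a, b, c, d)) ∧
      (∀ a b c d, componentsEquiv hf.basis W (c, d, a, b) =
        componentsEquiv hf.basis W (a, b, c, d)) ∧
      (∀ a b c d, componentsEquiv hf.basis W (a, b, c, d) +
        componentsEquiv hf.basis W (a, c, d, b) +
        componentsEquiv hf.basis W (a, d, b, c) = 0) ∧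
      ricciContraction nullSwap (componentsEquiv hf.basis W) = 0 := by
  have htr (x y : Fin (n + 2) → ℝ) := hf.sum_bilin (fixSecondFourth W x y)
  simp only [fixSecondFourth_apply] at htr
  constructor
  · rintro ⟨w1, w2, w3, w4⟩
    refine ⟨fun _ _ _ _ => w1 _ _ _ _, fun _ _ _ _ => w2 _ _ _ _, fun _ _ _ _ => w3 _ _ _ _, ?_⟩
    ext ⟨a, b⟩
    simp only [ricciContraction, LinearMap.coe_mk, AddHom.coe_mk, componentsEquiv_apply,
      hf.basis_apply, ← htr, w4, Pi.zero_apply]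
  · rintro ⟨w1, w2, w3, w4⟩
    refine ⟨fun x y z w => ?_, fun x y z w => ?_, fun x y z w => ?_, fun x y => ?_⟩
    · have h := apply_eq_zero_of_basis hf.basis
        (W := W.domDomCongr ⟨![1, 0, 2, 3], ![1, 0, 2, 3], by decide, by decide⟩ + W)
        (fun a b c d => by
          rw [add_apply, MultilinearMap.domDomCongr_vec_four]
          exact eq_neg_iff_add_eq_zero.mp (w1 a b c d)) ![x, y, z, w]
      rw [add_apply, MultilinearMap.domDomCongr_vec_four] at h
      exact eq_neg_iff_add_eq_zero.mpr h
    · have h := apply_eq_zero_of_basis hf.basis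
        (W := W.domDomCongr ⟨![2, 3, 0, 1], ![2, 3, 0, 1], by decide, by decide⟩ - W)
        (fun a b c d => by
          rw [sub_apply, MultilinearMap.domDomCongr_vec_four]
          exact sub_eq_zero.mpr (w2 a b c d)) ![x, y, z, w]
      rw [sub_apply, MultilinearMap.domDomCongr_vec_four] at h
      exact sub_eq_zero.mp h
    · have h := apply_eq_zero_of_basis hf.basis
        (W := W + W.domDomCongr ⟨![0, 2, 3, 1], ![0, 3, 1, 2], by decide, by decide⟩
          + W.domDomCongr ⟨![0, 3, 1, 2], ![0, 2, 3, 1], by decide, by decide⟩)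
        (fun a b c d => by
          simp only [add_apply, MultilinearMap.domDomCongr_vec_four]
          exact w3 a b c d) ![x, y, z, w]
      simp only [add_apply, MultilinearMap.domDomCongr_vec_four] at h
      exact h
    · let W' := W.domDomCongr ⟨![1, 0, 3, 2], ![1, 0, 3, 2], by decide, by decide⟩
      have hW' (u v x y : Fin (n + 2) → ℝ) : fixSecondFourth W' u v x y = W ![u, x, v, y] :=
        W.domDomCongr_vec_four _ _
      have hL : ∑ A, fixSecondFourth W' (f A) (f (nullSwap A)) = 0 := by
        refine hf.basis.ext fun a => hf.basis.ext fun b => ?_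
        simpa [ricciContraction, LinearMap.sum_apply, hW', componentsEquiv_apply, hf.basis_apply]
          using congrFun w4 (a, b)
      rw [htr]
      simpa [LinearMap.sum_apply, hW'] using congrFun (congrArg DFunLike.coe
        (congrFun (congrArg DFunLike.coe hL) x)) y

end Frame

section Decomposition

variable {n : ℕ} {f : Fin (n + 2) → Fin (n + 2) → ℝ}

theorem IsNullFrame.mem_weylPure_iff (hf : IsNullFrame f) {β : ℤ} {W : weylSubmodule (n + 2)} :
    W ∈ weylPure (n + 2) f β ↔ ∀ a b c d, bw a + bw b + bw c + bw d ≠ β →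
      componentsEquiv hf.basis W.1 (a, b, c, d) = 0 := by
  have hv (A : Fin 4 → Fin (n + 2)) :
      (fun k => f (A k)) = ![f (A 0), f (A 1), f (A 2), f (A 3)] := by
    ext i; fin_cases i <;> rfl
  simp only [componentsEquiv_apply, hf.basis_apply]
  constructor
  · intro h a b c d hne
    have := h ![a, b, c, d] (by simpa [Fin.sum_univ_four] using hne)
    rwa [hv] at this
  · intro h A hA
    rw [hv]
    exact h _ _ _ _ (by rwa [Fin.sum_univ_four] at hA)

theorem IsNullFrame.finrank_weylPure (hf : IsNullFrame f) (β : ℤ) :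
    Module.finrank ℝ (weylPure (n + 2) f β) =
      Module.finrank ℝ (weylArrays nullSwap (bw (N := n + 2)) β) := by
  have : weylArrays nullSwap (bw (N := n + 2)) β =
      ((weylPure (n + 2) f β).map (weylSubmodule (n + 2)).subtype).map
        (componentsEquiv hf.basis : _ →ₗ[ℝ] _) := by
    ext T
    constructor
    · rintro ⟨⟨t1, t2, t3, t4⟩, t5⟩
      obtain ⟨W, rfl⟩ := (componentsEquiv hf.basis).surjective T
      have hW : IsWeyl W := (hf.isWeyl_iff W).mpr ⟨t1, t2, t3, t5⟩
      exact ⟨W, ⟨⟨W, hW⟩, hf.mem_weylPure_iff.mpr t4, rfl⟩, rfl⟩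
    · rintro ⟨_, ⟨W, hW, rfl⟩, rfl⟩
      obtain ⟨w1, w2, w3, w4⟩ := (hf.isWeyl_iff W.1).mp W.2
      exact ⟨⟨w1, w2, w3, hf.mem_weylPure_iff.mp hW⟩, w4⟩
  rw [this, LinearEquiv.finrank_map_eq, Submodule.finrank_map_subtype_eq]

theorem IsNullFrame.exists_mem_weylPure (hf : IsNullFrame f) (W : weylSubmodule (n + 2))
    (β : ℤ) : ∃ V ∈ weylPure (n + 2) f β, ∀ a b c d, componentsEquiv hf.basis V.1 (a, b, c, d) =
      if bw a + bw b + bw c + bw d = β then componentsEquiv hf.basis W.1 (a, b, c, d) else 0 := by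
  obtain ⟨w1, w2, w3, w4⟩ := (hf.isWeyl_iff W.1).mp W.2
  obtain ⟨V, hV⟩ := (componentsEquiv hf.basis).surjective fun p =>
    if bw p.1 + bw p.2.1 + bw p.2.2.1 + bw p.2.2.2 = β
      then componentsEquiv hf.basis W.1 p else 0
  have hV' (a b c d) : componentsEquiv hf.basis V (a, b, c, d) =
      if bw a + bw b + bw c + bw d = β then componentsEquiv hf.basis W.1 (a, b, c, d) else 0 :=
    congrFun hV (a, b, c, d)
  have hWeyl : IsWeyl V := by
    refine (hf.isWeyl_iff V).mpr
      ⟨fun a b c d => ?_, fun a b c d => ?_, fun a b c d => ?_, ?_⟩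
    · rw [hV', hV', w1 a b c d, add_comm (bw b)]
      split_ifs <;> simp
    · rw [hV', hV', w2 a b c d, show bw c + bw d + bw a + bw b = bw a + bw b + bw c + bw d by ring]
    · rw [hV', hV', hV', show bw a + bw c + bw d + bw b = bw a + bw b + bw c + bw d by ring,
        show bw a + bw d + bw b + bw c = bw a + bw b + bw c + bw d by ring]
      split_ifs
      · exact w3 a b c d
      · simp
    · ext ⟨a, b⟩
      have h (c : Fin (n + 2)) : bw c + bw a + bw (nullSwap c) + bw b = bw a + bw b := by
        rw [bw_nullSwap]; ring
      simp only [ricciContraction, LinearMap.coe_mk, AddHom.coe_mk, hV', h]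
      split_ifs
      · exact congrFun w4 (a, b)
      · simp
  exact ⟨⟨V, hWeyl⟩, hf.mem_weylPure_iff.mpr fun a b c d hne => (hV' a b c d).trans (if_neg hne),
    hV'⟩

theorem abs_bw_add_bw_le {a b : Fin (n + 2)} (hab : a ≠ b) : |bw a + bw b| ≤ 1 := by
  rw [Ne, Fin.ext_iff] at hab
  unfold bw
  rw [abs_le]
  split_ifs <;> omega

theorem IsNullFrame.component_eq_zero (hf : IsNullFrame f) (W : weylSubmodule (n + 2))
    {a b c d : Fin (n + 2)} (h : 2 < |bw a + bw b + bw c + bw d|) :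
    componentsEquiv hf.basis W.1 (a, b, c, d) = 0 := by
  obtain ⟨w1, w2, -, -⟩ := (hf.isWeyl_iff W.1).mp W.2
  by_cases hab : a = b
  · subst hab
    linarith [w1 a a c d]
  by_cases hcd : c = d
  · subst hcd
    linarith [w1 c c a b, w2 a b c c]
  · have h1 := abs_le.mp (abs_bw_add_bw_le hab)
    have h2 := abs_le.mp (abs_bw_add_bw_le hcd)
    rw [lt_abs] at h
    omega

theorem IsNullFrame.eq_zero_of_mem_iSup (hf : IsNullFrame f) {κ : Type*} {w : κ → ℤ} {β : ℤ}
    {W : weylSubmodule (n + 2)} (hW : W ∈ weylPure (n + 2) f β)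
    (hW' : W ∈ ⨆ (j) (_ : w j ≠ β), weylPure (n + 2) f (w j)) : W = 0 := by
  let Z : Submodule ℝ (weylSubmodule (n + 2)) := LinearMap.ker
    (LinearMap.funLeft ℝ ℝ (Subtype.val : {p : Fin (n + 2) × Fin (n + 2) × Fin (n + 2) × Fin (n + 2)
      // bw p.1 + bw p.2.1 + bw p.2.2.1 + bw p.2.2.2 = β} → _) ∘ₗ
      (componentsEquiv hf.basis).toLinearMap ∘ₗ (weylSubmodule (n + 2)).subtype)
  have hle : (⨆ (j) (_ : w j ≠ β), weylPure (n + 2) f (w j)) ≤ Z := by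
    refine iSup₂_le fun j hj V hV => LinearMap.mem_ker.mpr ?_
    ext ⟨⟨a, b, c, d⟩, h⟩
    exact hf.mem_weylPure_iff.mp hV a b c d fun h' => hj (h'.symm.trans h)
  refine Subtype.ext ((componentsEquiv hf.basis).injective ?_)
  ext ⟨a, b, c, d⟩
  rw [Submodule.coe_zero, map_zero, Pi.zero_apply]
  by_cases h : bw a + bw b + bw c + bw d = β
  · exact congrFun (LinearMap.mem_ker.mp (hle hW')) ⟨(a, b, c, d), h⟩
  · exact hf.mem_weylPure_iff.mp hW a b c d h

theorem IsNullFrame.iSup_weylPure (hf : IsNullFrame f) {κ : Type*} [Fintype κ] {w : κ → ℤ}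
    (hinj : w.Injective) (hw : ∀ k : ℤ, |k| ≤ 2 → ∃ i, w i = k) :
    ⨆ i, weylPure (n + 2) f (w i) = ⊤ := by
  classical
  refine eq_top_iff.mpr fun W _ => ?_
  choose V hV hVc using hf.exists_mem_weylPure W
  have hW : W = ∑ i, V (w i) := by
    refine Subtype.ext ((componentsEquiv hf.basis).injective ?_)
    ext ⟨a, b, c, d⟩
    rw [Submodule.coe_sum, map_sum, Finset.sum_apply]
    simp only [hVc]
    by_cases h : 2 < |bw a + bw b + bw c + bw d|
    · simp [hf.component_eq_zero W h]
    · obtain ⟨i, hi⟩ := hw _ (not_lt.mp h)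
      simp only [← hi, hinj.eq_iff, Finset.sum_ite_eq, Finset.mem_univ, if_true]
  rw [hW]
  exact Submodule.sum_mem _ fun i _ => Submodule.mem_iSup_of_mem i (hV _)

theorem isInternal_of_iSupIndep_of_iSup_eq_top {R M κ : Type*} [Ring R] [AddCommMonoid M]
    [Module R M] [DecidableEq κ] {A : κ → Submodule R M} (hind : iSupIndep A)
    (htop : ⨆ i, A i = ⊤) : DirectSum.IsInternal A := by
  let := Module.addCommMonoidToAddCommGroup R (M := M)
  exact DirectSum.isInternal_submodule_of_iSupIndep_of_iSup_eq_top hind htop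

theorem IsNullFrame.isInternal_weylPure (hf : IsNullFrame f) {κ : Type*} [Fintype κ]
    [DecidableEq κ] {w : κ → ℤ} (hinj : w.Injective) (hw : ∀ k : ℤ, |k| ≤ 2 → ∃ i, w i = k) :
    DirectSum.IsInternal (fun i => weylPure (n + 2) f (w i)) := by
  have hind : iSupIndep fun i => weylPure (n + 2) f (w i) := by
    intro i
    rw [Submodule.disjoint_def]
    intro W hW hW'
    refine hf.eq_zero_of_mem_iSup (w := w) hW ?_
    simpa only [hinj.ne_iff] using hW'
  have htop := hf.iSup_weylPure hinj hw
  exact isInternal_of_iSupIndep_of_iSup_eq_top hind htop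

end Decomposition

/-- For `N ≥ 4` and a null frame of `ℝ^N`, the space of Weyl tensors
is the direct sum of its pure boost weight subspaces for `b = 2, 1, 0, -1, -2`, with
`dim = N(N-3)/2` for `b = ±2`, `dim = (N-1)(N-2)(N-3)/3` for `b = ±1`, and
`dim = (N-2)²((N-2)²-1)/12 + (N-2)(N-3)/2` for `b = 0`. -/
theorem stmt_6 (N : ℕ) [NeZero N] (hN : 4 ≤ N)
    (f : Fin N → Fin N → ℝ) (hf : IsNullFrame f) :
    DirectSum.IsInternal (fun i : Fin 5 => weylPure N f (![2, 1, 0, -1, -2] i)) ∧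
    Module.finrank ℝ (weylPure N f 2) = N * (N - 3) / 2 ∧
    Module.finrank ℝ (weylPure N f (-2)) = N * (N - 3) / 2 ∧
    Module.finrank ℝ (weylPure N f 1) = (N - 1) * (N - 2) * (N - 3) / 3 ∧
    Module.finrank ℝ (weylPure N f (-1)) = (N - 1) * (N - 2) * (N - 3) / 3 ∧
    Module.finrank ℝ (weylPure N f 0)
      = (N - 2) ^ 2 * ((N - 2) ^ 2 - 1) / 12 + (N - 2) * (N - 3) / 2 := by
  obtain ⟨m, rfl⟩ : ∃ m, N = m + 2 + 2 := ⟨N - 4, by omega⟩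
  have key (β : ℤ) := finrank_weylArrays (n := m + 2) (by omega) β
  have e1 : m + 2 + 2 - 1 = m + 3 := rfl
  have e2 : m + 2 + 2 - 2 = m + 2 := rfl
  have e3 : m + 2 + 2 - 3 = m + 1 := rfl
  have dim_two (F : ℕ) (h : (12 * F : ℝ) = 6 * (m + 2 + 2) * (m + 2 - 1)) :
      F = (m + 2 + 2) * (m + 1) / 2 := by
    refine (Nat.div_eq_of_eq_mul_right two_pos ?_).symm
    rw [← Nat.cast_inj (R := ℝ)]
    push_cast
    linear_combination (-1 / 6) * h
  have dim_one (F : ℕ) (h : (12 * F : ℝ) = 4 * (m + 2 + 1) * (m + 2) * (m + 2 - 1)) :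
      F = (m + 3) * (m + 2) * (m + 1) / 3 := by
    refine (Nat.div_eq_of_eq_mul_right three_pos ?_).symm
    rw [← Nat.cast_inj (R := ℝ)]
    push_cast
    linear_combination (-1 / 4) * h
  rw [e1, e2, e3]
  refine ⟨hf.isInternal_weylPure (by decide) fun k hk => ?_, ?_, ?_, ?_, ?_, ?_⟩
  · obtain ⟨h1, h2⟩ := abs_le.mp hk
    interval_cases k <;> decide
  · exact dim_two _ (by simpa [hf.finrank_weylPure] using key 2)
  · exact dim_two _ (by simpa [hf.finrank_weylPure] using key (-2))
  · exact dim_one _ (by simpa [hf.finrank_weylPure] using key 1)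
  · exact dim_one _ (by simpa [hf.finrank_weylPure] using key (-1))
  · obtain ⟨C, hC⟩ := (Nat.even_mul_succ_self (m + 1)).two_dvd
    have h : 12 * Module.finrank ℝ (weylPure (m + 2 + 2) f 0) =
        (m + 2) ^ 2 * ((m + 2) ^ 2 - 1) + 6 * ((m + 1) * (m + 1 + 1)) := by
      rw [← Nat.cast_inj (R := ℝ), hf.finrank_weylPure]
      push_cast [Nat.cast_sub (Nat.one_le_pow 2 (m + 2) (by omega))]
      have := key 0
      norm_num at this
      linear_combination this
    rw [show (m + 2) * (m + 1) = 2 * C by rw [← hC]; ring]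
    rw [hC] at h
    omega
end

section
/- Let N ≥ 5. Then the set of Weyl tensors on ℝ^N possessing no WAND (alignment type G) is a dense open subset of the finite-dimensional real vector space of all Weyl tensors on ℝ^N; equivalently, the set of Weyl tensors possessing at least one WAND is closed with empty interior. -/
/-- A Weyl tensor on `ℝ^N`, here realized as a continuous 4-linear form (on the
finite-dimensional space `ℝ^N` every multilinear form is continuous, so this is the
same space of tensors, but it carries the canonical topology of a finite-dimensional
real vector space). -/
def IsWeylC {N : ℕ}
    (W : ContinuousMultilinearMap ℝ (fun _ : Fin 4 => (Fin N → ℝ)) ℝ) : Prop :=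
  (∀ x y z w : Fin N → ℝ, W ![y, x, z, w] = - W ![x, y, z, w]) ∧
  (∀ x y z w : Fin N → ℝ, W ![z, w, x, y] = W ![x, y, z, w]) ∧
  (∀ x y z w : Fin N → ℝ,
    W ![x, y, z, w] + W ![x, z, w, y] + W ![x, w, y, z] = 0) ∧
  (∀ x y : Fin N → ℝ,
    ∑ a : Fin N, (if (a : ℕ) = 0 then (-1 : ℝ) else 1) *
      W ![Pi.single a 1, x, Pi.single a 1, y] = 0)

/-- `W` possesses a Weyl aligned null direction (WAND): a nonzero null vector `k` with
`W(k,x,k,y) = 0` for all `x, y` orthogonal to `k`. -/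
def HasWAND {N : ℕ}
    (W : ContinuousMultilinearMap ℝ (fun _ : Fin 4 => (Fin N → ℝ)) ℝ) : Prop :=
  ∃ k : Fin N → ℝ, k ≠ 0 ∧ eta k k = 0 ∧
    ∀ x y : Fin N → ℝ, eta k x = 0 → eta k y = 0 → W ![k, x, k, y] = 0

/-- Evaluation of a 4-linear form when its first and third arguments are rescaled. -/
lemma apply_smul_smul {N : ℕ} (W : ContinuousMultilinearMap ℝ (fun _ : Fin 4 => (Fin N → ℝ)) ℝ)
    (c : ℝ) (k x y : Fin N → ℝ) :
    W ![c • k, x, c • k, y] = c * c * W ![k, x, k, y] := by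
  have h := W.map_smul_univ ![c, 1, c, 1] ![k, x, k, y]
  have e : (fun i => (![c, 1, c, 1] : Fin 4 → ℝ) i • (![k, x, k, y] : Fin 4 → Fin N → ℝ) i)
      = ![c • k, x, c • k, y] := by
    funext i
    fin_cases i <;> simp
  rw [e] at h
  rw [h]
  simp [Fin.prod_univ_four]

lemma eta_smul_left {N : ℕ} (c : ℝ) (x y : Fin N → ℝ) : eta (c • x) y = c * eta x y := by
  unfold eta
  rw [Finset.mul_sum]
  refine Finset.sum_congr rfl fun a _ => ?_
  split_ifs <;> simp only [Pi.smul_apply, smul_eq_mul] <;> ring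

lemma eta_smul_self {N : ℕ} (c : ℝ) (x : Fin N → ℝ) : eta (c • x) (c • x) = c * c * eta x x := by
  unfold eta
  rw [Finset.mul_sum]
  refine Finset.sum_congr rfl fun a _ => ?_
  split_ifs <;> simp only [Pi.smul_apply, smul_eq_mul] <;> ring

lemma continuous_eta {N : ℕ} : Continuous fun p : (Fin N → ℝ) × (Fin N → ℝ) => eta p.1 p.2 := by
  unfold eta
  refine continuous_finsetSum _ fun a _ => ?_
  split_ifs <;> fun_prop

lemma eta_eq {m : ℕ} (x y : Fin (m + 2) → ℝ) :
    eta x y = -(x 0 * y 0) + x 1 * y 1 + ∑ i : Fin m, x i.succ.succ * y i.succ.succ := by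
  unfold eta
  rw [Fin.sum_univ_succ, Fin.sum_univ_succ]
  simp [add_assoc]

/-- The celestial sphere: null vectors with time component `1`. -/
def celestialSphere (m : ℕ) : Set (Fin (m + 2) → ℝ) := {k | k 0 = 1 ∧ eta k k = 0}

lemma isCompact_celestialSphere (m : ℕ) : IsCompact (celestialSphere m) := by
  refine Metric.isCompact_of_isClosed_isBounded ?_ ?_
  · exact (isClosed_eq (continuous_apply 0) continuous_const).inter
      (isClosed_eq (continuous_eta.comp (continuous_id.prodMk continuous_id)) continuous_const)
  · refine (Metric.isBounded_closedBall (x := (0 : Fin (m + 2) → ℝ)) (r := 1)).subset ?_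
    rintro k ⟨h0, hk⟩
    rw [mem_closedBall_zero_iff, pi_norm_le_iff_of_nonneg zero_le_one]
    rw [eta_eq, h0] at hk
    have hs : ∀ i : Fin m, k i.succ.succ * k i.succ.succ
        ≤ ∑ i : Fin m, k i.succ.succ * k i.succ.succ := fun i =>
      Finset.single_le_sum (f := fun i : Fin m => k i.succ.succ * k i.succ.succ)
        (fun j _ => mul_self_nonneg _) (Finset.mem_univ i)
    have hs0 : 0 ≤ ∑ i : Fin m, k i.succ.succ * k i.succ.succ :=
      Finset.sum_nonneg fun j _ => mul_self_nonneg _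
    intro i
    rw [Real.norm_eq_abs, abs_le_one_iff_mul_self_le_one]
    refine Fin.cases ?_ (fun i => Fin.cases ?_ (fun i => ?_) i) i
    · simp [h0]
    · have : k (Fin.succ 0) = k 1 := rfl
      rw [this]
      linarith
    · linarith [hs i, mul_self_nonneg (k 1)]

lemma time_component_ne_zero {m : ℕ} {k : Fin (m + 2) → ℝ} (hk : k ≠ 0) (h : eta k k = 0) :
    k 0 ≠ 0 := by
  intro h0
  apply hk
  rw [eta_eq, h0] at h
  have hs0 : 0 ≤ ∑ i : Fin m, k i.succ.succ * k i.succ.succ :=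
    Finset.sum_nonneg fun j _ => mul_self_nonneg _
  have h1 : k 1 * k 1 = 0 := by linarith [mul_self_nonneg (k 1)]
  have h2 : ∑ i : Fin m, k i.succ.succ * k i.succ.succ = 0 := by linarith
  rw [Finset.sum_eq_zero_iff_of_nonneg fun j _ => mul_self_nonneg _] at h2
  funext i
  refine Fin.cases h0 (fun i => Fin.cases ?_ (fun i => ?_) i) i
  · exact mul_self_eq_zero.1 h1
  · exact mul_self_eq_zero.1 (h2 i (Finset.mem_univ i))

lemma eta_add_smul_single {m : ℕ} {k : Fin (m + 2) → ℝ} (hk : k 0 = 1) (x : Fin (m + 2) → ℝ) :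
    eta k (x + eta k x • Pi.single 0 1) = 0 := by
  set c := eta k x with hc
  rw [eta_eq] at hc ⊢
  have h1 : (1 : Fin (m + 2)) ≠ 0 := by simp
  simp only [Pi.add_apply, Pi.smul_apply, Pi.single_eq_same, smul_eq_mul,
    Pi.single_eq_of_ne h1, Pi.single_eq_of_ne (Fin.succ_ne_zero _), mul_zero, add_zero, hk]
    at hc ⊢
  linarith

/-- WANDs can be searched for on the celestial sphere, with test vectors projected onto `k^⊥`. -/
lemma hasWAND_iff_exists_celestialSphere {m : ℕ}
    (W : ContinuousMultilinearMap ℝ (fun _ : Fin 4 => (Fin (m + 2) → ℝ)) ℝ) :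
    HasWAND W ↔ ∃ k ∈ celestialSphere m, ∀ x y : Fin (m + 2) → ℝ,
      W ![k, x + eta k x • Pi.single 0 1, k, y + eta k y • Pi.single 0 1] = 0 := by
  constructor
  · rintro ⟨k, hk, hkk, h⟩
    have h0 := time_component_ne_zero hk hkk
    have hs : (k 0)⁻¹ • k ∈ celestialSphere m :=
      ⟨by simp [h0], by rw [eta_smul_self, hkk, mul_zero]⟩
    refine ⟨(k 0)⁻¹ • k, hs, fun x y => ?_⟩
    have hx := eta_add_smul_single hs.1 x
    have hy := eta_add_smul_single hs.1 y
    rw [eta_smul_left] at hx hy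
    have hi : (k 0)⁻¹ ≠ 0 := inv_ne_zero h0
    rw [apply_smul_smul, h _ _ ((mul_eq_zero.1 hx).resolve_left hi)
      ((mul_eq_zero.1 hy).resolve_left hi), mul_zero]
  · rintro ⟨k, ⟨h0, hkk⟩, h⟩
    refine ⟨k, fun hk => by simp [hk] at h0, hkk, fun x y hx hy => ?_⟩
    have := h x y
    rwa [hx, hy, zero_smul, add_zero, add_zero] at this

lemma isClosed_setOf_hasWAND (m : ℕ) :
    IsClosed {W : ContinuousMultilinearMap ℝ (fun _ : Fin 4 => (Fin (m + 2) → ℝ)) ℝ |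
      HasWAND W} := by
  have : CompactSpace (celestialSphere m) :=
    isCompact_iff_compactSpace.1 (isCompact_celestialSphere m)
  let Z : Set (celestialSphere m ×
      ContinuousMultilinearMap ℝ (fun _ : Fin 4 => (Fin (m + 2) → ℝ)) ℝ) :=
    {p | ∀ x y : Fin (m + 2) → ℝ, p.2 ![p.1.1, x + eta p.1.1 x • Pi.single 0 1,
      p.1.1, y + eta p.1.1 y • Pi.single 0 1] = 0}
  have hZ : IsClosed Z := by
    simp only [Z, Set.ofPred_forall]
    refine isClosed_iInter fun x => isClosed_iInter fun y => isClosed_eq ?_ continuous_const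
    have he : ∀ x : Fin (m + 2) → ℝ, Continuous fun p : celestialSphere m ×
        ContinuousMultilinearMap ℝ (fun _ : Fin 4 => (Fin (m + 2) → ℝ)) ℝ => eta p.1.1 x :=
      fun x => continuous_eta.comp
        ((continuous_subtype_val.comp continuous_fst).prodMk continuous_const)
    refine Continuous.eval continuous_snd (continuous_pi fun i => ?_)
    have := he x
    have := he y
    fin_cases i <;> simp <;> fun_prop
  convert isClosedMap_snd_of_compactSpace _ hZ using 1
  ext W
  rw [Set.mem_ofPred_eq, hasWAND_iff_exists_celestialSphere]
  simp [Z]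

/-- The null covector `x ↦ -x₀ + σ x₁` (for `σ² = 1`). -/
def nullForm (m : ℕ) (σ : ℝ) : (Fin (m + 2) → ℝ) →L[ℝ] ℝ :=
  -ContinuousLinearMap.proj 0 + σ • ContinuousLinearMap.proj 1

lemma nullForm_apply {m : ℕ} (σ : ℝ) (x : Fin (m + 2) → ℝ) :
    nullForm m σ x = -x 0 + σ * x 1 := by
  simp [nullForm]

/-- The product of four linear forms. -/
def productForm {m : ℕ} (f g h k : (Fin (m + 2) → ℝ) →L[ℝ] ℝ) :
    ContinuousMultilinearMap ℝ (fun _ : Fin 4 => (Fin (m + 2) → ℝ)) ℝ :=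
  (ContinuousMultilinearMap.mkPiAlgebra ℝ (Fin 4) ℝ).compContinuousLinearMap ![f, g, h, k]

lemma productForm_apply {m : ℕ} (f g h k : (Fin (m + 2) → ℝ) →L[ℝ] ℝ)
    (x y z w : Fin (m + 2) → ℝ) :
    productForm f g h k ![x, y, z, w] = f x * g y * h z * k w := by
  simp [productForm, Fin.prod_univ_four]

/-- The coordinate form `x ↦ x_{i+2}` transverse to the null plane. -/
def transverseCoord {m : ℕ} (i : Fin m) : (Fin (m + 2) → ℝ) →L[ℝ] ℝ :=
  ContinuousLinearMap.proj i.succ.succ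

/-- The transverse bilinear form with matrix `A`. -/
def transverseForm {m : ℕ} (A : Fin m → Fin m → ℝ) (x y : Fin (m + 2) → ℝ) : ℝ :=
  ∑ i, ∑ j, A i j * (x i.succ.succ * y j.succ.succ)

/-- The type **N** Weyl tensor attached to a null covector and a transverse matrix: the
Kulkarni–Nomizu product of the square of the covector with the transverse form. -/
def typeN {m : ℕ} (σ : ℝ) (A : Fin m → Fin m → ℝ) :
    ContinuousMultilinearMap ℝ (fun _ : Fin 4 => (Fin (m + 2) → ℝ)) ℝ :=
  ∑ i, ∑ j, A i j •
    (productForm (nullForm m σ) (transverseCoord i) (nullForm m σ) (transverseCoord j)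
    - productForm (transverseCoord i) (nullForm m σ) (nullForm m σ) (transverseCoord j)
    - productForm (nullForm m σ) (transverseCoord i) (transverseCoord j) (nullForm m σ)
    + productForm (transverseCoord i) (nullForm m σ) (transverseCoord j) (nullForm m σ))

lemma continuous_typeN {m : ℕ} (σ : ℝ) : Continuous (typeN (m := m) σ) := by
  unfold typeN
  fun_prop

lemma typeN_apply {m : ℕ} (σ : ℝ) (A : Fin m → Fin m → ℝ) (x y z w : Fin (m + 2) → ℝ) :
    typeN σ A ![x, y, z, w] =
      nullForm m σ x * nullForm m σ z * transverseForm A y w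
      - nullForm m σ y * nullForm m σ z * transverseForm A x w
      - nullForm m σ x * nullForm m σ w * transverseForm A y z
      + nullForm m σ y * nullForm m σ w * transverseForm A x z := by
  simp only [typeN, transverseForm, Finset.mul_sum, ← Finset.sum_sub_distrib,
    ← Finset.sum_add_distrib, sum_apply,
    smul_apply, add_apply,
    sub_apply, productForm_apply, transverseCoord,
    ContinuousLinearMap.proj_apply, smul_eq_mul]
  refine Finset.sum_congr rfl fun i _ => Finset.sum_congr rfl fun j _ => ?_
  ring

lemma transverseForm_comm {m : ℕ} {A : Fin m → Fin m → ℝ} (hA : ∀ i j, A i j = A j i)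
    (x y : Fin (m + 2) → ℝ) : transverseForm A x y = transverseForm A y x := by
  unfold transverseForm
  rw [Finset.sum_comm]
  refine Finset.sum_congr rfl fun i _ => Finset.sum_congr rfl fun j _ => ?_
  rw [hA]
  ring

lemma transverseForm_of_forall_eq_zero {m : ℕ} (A : Fin m → Fin m → ℝ) {x : Fin (m + 2) → ℝ}
    (hx : ∀ i : Fin m, x i.succ.succ = 0) (y : Fin (m + 2) → ℝ) : transverseForm A x y = 0 := by
  simp [transverseForm, hx]

lemma transverseForm_of_eq_single {m : ℕ} (A : Fin m → Fin m → ℝ) {x y : Fin (m + 2) → ℝ}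
    {i j : Fin m} (hx : ∀ a : Fin m, x a.succ.succ = Pi.single (M := fun _ => ℝ) i 1 a)
    (hy : ∀ a : Fin m, y a.succ.succ = Pi.single (M := fun _ => ℝ) j 1 a) :
    transverseForm A x y = A i j := by
  simp only [transverseForm, hx, hy, Pi.single_apply]
  simp

lemma isWeylC_typeN {m : ℕ} {σ : ℝ} (hσ : σ * σ = 1) {A : Fin m → Fin m → ℝ}
    (hA : ∀ i j, A i j = A j i) (htr : ∑ i, A i i = 0) : IsWeylC (typeN σ A) := by
  have hc := transverseForm_comm hA
  refine ⟨fun x y z w => ?_, fun x y z w => ?_, fun x y z w => ?_, fun x y => ?_⟩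
  · simp only [typeN_apply]
    ring
  · simp only [typeN_apply]
    rw [hc w y, hc w x, hc z y, hc z x]
    ring
  · simp only [typeN_apply]
    rw [hc w z, hc w y, hc z y]
    ring
  · have h0 : ∀ y, transverseForm A (Pi.single 0 1) y = 0 :=
      transverseForm_of_forall_eq_zero A fun i => Pi.single_eq_of_ne (Fin.succ_ne_zero _) _
    have h1 : ∀ y, transverseForm A (Pi.single (Fin.succ 0) 1) y = 0 :=
      transverseForm_of_forall_eq_zero A fun i =>
        Pi.single_eq_of_ne (by simp [Fin.ext_iff]) _
    have h2 : ∀ i : Fin m, transverseForm A (Pi.single i.succ.succ 1) (Pi.single i.succ.succ 1)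
        = A i i := fun i => by
      apply transverseForm_of_eq_single <;> intro a <;> simp [Pi.single_apply]
    have l0 : nullForm m σ (Pi.single 0 1) = -1 := by simp [nullForm_apply]
    have l1 : nullForm m σ (Pi.single (Fin.succ 0) 1) = σ := by
      simp [nullForm_apply]
    have l2 : ∀ i : Fin m, nullForm m σ (Pi.single i.succ.succ 1) = 0 := fun i => by
      rw [nullForm_apply, Pi.single_eq_of_ne (Fin.succ_ne_zero _).symm,
        Pi.single_eq_of_ne (by simp [Fin.ext_iff])]
      simp
    rw [Fin.sum_univ_succ, Fin.sum_univ_succ]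
    simp only [typeN_apply, h0, h1, h2, l0, l1, l2, hc x (Pi.single 0 1),
      hc x (Pi.single (Fin.succ 0) 1), Fin.val_succ, Fin.val_zero]
    have : ∑ i : Fin m, nullForm m σ x * nullForm m σ y * A i i = 0 := by
      rw [← Finset.mul_sum, htr, mul_zero]
    simp [this]
    linear_combination transverseForm A x y * hσ

/-- An `(r+4)`-dimensional family of symmetric trace-free `(r+3) × (r+3)` matrices, parametrized
by the first row and the entry in position `(1, 2)`. -/
def traceFreeFamily {r : ℕ} (c : Option (Fin (r + 3)) → ℝ) (i j : Fin (r + 3)) : ℝ :=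
  if i = 0 then c (some j)
  else if j = 0 then c (some i)
  else if i = 1 ∧ j = 1 then -c (some 0)
  else if (i = 1 ∧ j = 2) ∨ (i = 2 ∧ j = 1) then c none
  else 0

lemma traceFreeFamily_comm {r : ℕ} (c : Option (Fin (r + 3)) → ℝ) (i j : Fin (r + 3)) :
    traceFreeFamily c i j = traceFreeFamily c j i := by
  unfold traceFreeFamily
  grind

lemma fin_two_ne_zero {r : ℕ} : (2 : Fin (r + 3)) ≠ 0 := by
  rw [Ne, Fin.ext_iff, Fin.coe_ofNat_eq_mod, Nat.mod_eq_of_lt (by omega)]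
  simp

lemma fin_two_ne_one {r : ℕ} : (2 : Fin (r + 3)) ≠ 1 := by
  rw [Ne, Fin.ext_iff, Fin.coe_ofNat_eq_mod, Nat.mod_eq_of_lt (by omega)]
  simp

lemma sum_traceFreeFamily {r : ℕ} (c : Option (Fin (r + 3)) → ℝ) :
    ∑ i, traceFreeFamily c i i = 0 := by
  have h : ∀ i : Fin (r + 3), traceFreeFamily c i i
      = (if i = 0 then c (some 0) else 0) + if i = 1 then -c (some 0) else 0 := by
    intro i
    have h01 : (0 : Fin (r + 3)) ≠ 1 := by simp
    have h21 := fin_two_ne_one (r := r)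
    unfold traceFreeFamily
    grind
  simp [h, Finset.sum_add_distrib]

lemma continuous_traceFreeFamily {r : ℕ} : Continuous (traceFreeFamily (r := r)) := by
  refine continuous_pi fun i => continuous_pi fun j => ?_
  unfold traceFreeFamily
  split_ifs <;> fun_prop

lemma traceFreeFamily_zero {r : ℕ} : traceFreeFamily (0 : Option (Fin (r + 3)) → ℝ) = 0 := by
  funext i j
  simp [traceFreeFamily]

/-- The position of the matrix entry that reads off a parameter of `traceFreeFamily`. -/
def entryPosition {r : ℕ} : Option (Fin (r + 3)) → Fin (r + 3) × Fin (r + 3)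
  | none => (1, 2)
  | some j => (0, j)

lemma traceFreeFamily_entryPosition {r : ℕ} (c : Option (Fin (r + 3)) → ℝ)
    (p : Option (Fin (r + 3))) :
    traceFreeFamily c (entryPosition p).1 (entryPosition p).2 = c p := by
  cases p with
  | none =>
    have h21 := fin_two_ne_one (r := r)
    have h20 := fin_two_ne_zero (r := r)
    simp [traceFreeFamily, entryPosition, h21, h20]
  | some j => simp [traceFreeFamily, entryPosition]

/-- The vector with components `a`, `b` and transverse part `v`. -/
def ofComponents {m : ℕ} (a b : ℝ) (v : Fin m → ℝ) : Fin (m + 2) → ℝ :=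
  Fin.cons a (Fin.cons b v : Fin (m + 1) → ℝ)

@[simp] lemma ofComponents_zero {m : ℕ} (a b : ℝ) (v : Fin m → ℝ) : ofComponents a b v 0 = a := rfl

@[simp] lemma ofComponents_one {m : ℕ} (a b : ℝ) (v : Fin m → ℝ) : ofComponents a b v 1 = b := rfl

@[simp] lemma ofComponents_succ_succ {m : ℕ} (a b : ℝ) (v : Fin m → ℝ) (i : Fin m) :
    ofComponents a b v i.succ.succ = v i := rfl

lemma ext_components {m : ℕ} {x y : Fin (m + 2) → ℝ} (h0 : x 0 = y 0) (h1 : x 1 = y 1)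
    (h : ∀ i : Fin m, x i.succ.succ = y i.succ.succ) : x = y := by
  funext i
  exact Fin.cases h0 (fun i => Fin.cases h1 h i) i

lemma contDiff_ofComponents {E : Type*} [NormedAddCommGroup E] [NormedSpace ℝ E] {m : ℕ}
    {a b : E → ℝ} {v : E → Fin m → ℝ} (ha : ContDiff ℝ 1 a) (hb : ContDiff ℝ 1 b)
    (hv : ContDiff ℝ 1 v) : ContDiff ℝ 1 fun e => ofComponents (a e) (b e) (v e) := by
  rw [contDiff_pi]
  intro i
  refine Fin.cases ha (fun i => Fin.cases hb (fun i => ?_) i) i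
  exact contDiff_pi.1 hv i

/-- Parametrization of the null directions other than that of `(1, 1, 0)`. -/
noncomputable def paraboloid {m : ℕ} (v : Fin m → ℝ) : Fin (m + 2) → ℝ :=
  ofComponents (-(1 + ∑ i, v i * v i) / 2) ((1 - ∑ i, v i * v i) / 2) v

/-- A vector orthogonal to both `paraboloid v` and `(1, 1, 0)`. -/
def screenVector {m : ℕ} (v : Fin m → ℝ) (i : Fin m) : Fin (m + 2) → ℝ :=
  ofComponents (-v i) (-v i) (Pi.single i 1)

lemma contDiff_paraboloid {m : ℕ} : ContDiff ℝ 1 (paraboloid (m := m)) := by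
  unfold paraboloid
  refine contDiff_ofComponents ?_ ?_ contDiff_id <;> fun_prop

lemma contDiff_screenVector {m : ℕ} (i : Fin m) :
    ContDiff ℝ 1 fun v : Fin m → ℝ => screenVector v i := by
  unfold screenVector
  refine contDiff_ofComponents ?_ ?_ contDiff_const <;> fun_prop

lemma eta_paraboloid_screenVector {m : ℕ} (v : Fin m → ℝ) (i : Fin m) :
    eta (paraboloid v) (screenVector v i) = 0 := by
  simp [eta_eq, paraboloid, screenVector, Pi.single_apply]
  ring

/-- A null vector either is a multiple of `(1, 1, 0)` or of a point of the paraboloid. -/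
lemma eq_smul_of_null {m : ℕ} {k : Fin (m + 2) → ℝ} (h : eta k k = 0) :
    k = k 0 • ofComponents 1 1 0 ∨ ∃ a : ℝ, a ≠ 0 ∧ ∃ v : Fin m → ℝ, k = a • paraboloid v := by
  rw [eta_eq] at h
  by_cases ha : k 1 - k 0 = 0
  · left
    have hk : k 1 = k 0 := by linarith
    rw [hk] at h
    have h2 : ∑ i : Fin m, k i.succ.succ * k i.succ.succ = 0 := by linarith
    rw [Finset.sum_eq_zero_iff_of_nonneg fun j _ => mul_self_nonneg _] at h2
    refine ext_components (by simp) (by simp [hk]) fun i => ?_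
    simpa using h2 i (Finset.mem_univ i)
  · right
    refine ⟨k 1 - k 0, ha, fun i => (k 1 - k 0)⁻¹ * k i.succ.succ, ?_⟩
    have hs : ∑ i : Fin m, ((k 1 - k 0)⁻¹ * k i.succ.succ) * ((k 1 - k 0)⁻¹ * k i.succ.succ)
        = -(k 1 - k 0)⁻¹ * (k 1 + k 0) := by
      have : ∀ i : Fin m, ((k 1 - k 0)⁻¹ * k i.succ.succ) * ((k 1 - k 0)⁻¹ * k i.succ.succ)
          = (k 1 - k 0)⁻¹ * (k 1 - k 0)⁻¹ * (k i.succ.succ * k i.succ.succ) := fun i => by ring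
      simp only [this, ← Finset.mul_sum]
      rw [show ∑ i : Fin m, k i.succ.succ * k i.succ.succ = -(k 1 - k 0) * (k 1 + k 0) by
        linarith]
      field_simp
    refine ext_components ?_ ?_ fun i => ?_
    · simp only [paraboloid, Pi.smul_apply, ofComponents_zero, hs, smul_eq_mul]
      field_simp
      ring
    · simp only [paraboloid, Pi.smul_apply, ofComponents_one, hs, smul_eq_mul]
      field_simp
      ring
    · simp [paraboloid, ha]

lemma typeN_paraboloid {m : ℕ} (A : Fin m → Fin m → ℝ) (v : Fin m → ℝ) (i j : Fin m) :
    typeN 1 A ![paraboloid v, screenVector v i, paraboloid v, screenVector v j] = A i j := by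
  have h1 : nullForm m 1 (paraboloid v) = 1 := by
    simp [nullForm_apply, paraboloid]
    ring
  have h2 : ∀ i, nullForm m 1 (screenVector v i) = 0 := fun i => by
    simp [nullForm_apply, screenVector]
  have h3 : transverseForm A (screenVector v i) (screenVector v j) = A i j :=
    transverseForm_of_eq_single A (fun a => rfl) fun a => rfl
  simp [typeN_apply, h1, h2, h3]

lemma typeN_null {m : ℕ} (σ : ℝ) (A : Fin m → Fin m → ℝ) (i j : Fin m) :
    typeN σ A ![ofComponents 1 1 0, ofComponents 0 0 (Pi.single i 1), ofComponents 1 1 0,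
      ofComponents 0 0 (Pi.single j 1)] = (σ - 1) * (σ - 1) * A i j := by
  have h1 : nullForm m σ (ofComponents 1 1 0) = σ - 1 := by
    simp [nullForm_apply]
    ring
  have h2 : ∀ v, nullForm m σ (ofComponents 0 0 v) = 0 := fun v => by
    simp [nullForm_apply]
  have h3 : transverseForm A (ofComponents 0 0 (Pi.single i 1)) (ofComponents 0 0 (Pi.single j 1))
      = A i j := transverseForm_of_eq_single A (fun a => rfl) fun a => rfl
  simp [typeN_apply, h1, h2, h3]

lemma isWeylC_add {N : ℕ} {W V : ContinuousMultilinearMap ℝ (fun _ : Fin 4 => (Fin N → ℝ)) ℝ}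
    (hW : IsWeylC W) (hV : IsWeylC V) : IsWeylC (W + V) := by
  obtain ⟨a, b, c, d⟩ := hW
  obtain ⟨a', b', c', d'⟩ := hV
  refine ⟨fun x y z w => ?_, fun x y z w => ?_, fun x y z w => ?_, fun x y => ?_⟩
  · simp only [add_apply]
    rw [a, a']
    ring
  · simp only [add_apply]
    rw [b, b']
  · simp only [add_apply]
    linear_combination c x y z w + c' x y z w
  · simp only [add_apply, mul_add, Finset.sum_add_distrib]
    rw [d, d', add_zero]

/-- The parameters `c` for which `W + typeN 1 (traceFreeFamily c)` has a WAND on the paraboloid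
lie in the range of this map. -/
noncomputable def wandParameter {r : ℕ}
    (W : ContinuousMultilinearMap ℝ (fun _ : Fin 4 => (Fin (r + 3 + 2) → ℝ)) ℝ)
    (v : Fin (r + 3) → ℝ) (p : Option (Fin (r + 3))) : ℝ :=
  -W ![paraboloid v, screenVector v (entryPosition p).1,
    paraboloid v, screenVector v (entryPosition p).2]

lemma dense_compl_range_wandParameter {r : ℕ}
    (W : ContinuousMultilinearMap ℝ (fun _ : Fin 4 => (Fin (r + 3 + 2) → ℝ)) ℝ) :
    Dense (Set.range (wandParameter W))ᶜ := by
  refine ContDiff.dense_compl_range_of_finrank_lt_finrank ?_ (by simp)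
  rw [contDiff_pi]
  intro p
  refine (W.contDiff.comp (contDiff_pi.2 fun i => ?_)).neg
  have h1 := contDiff_paraboloid (m := r + 3)
  have h2 := contDiff_screenVector (m := r + 3)
  fin_cases i
  · exact h1
  · exact h2 _
  · exact h1
  · exact h2 _

lemma not_hasWAND_add_typeN {r : ℕ}
    {W : ContinuousMultilinearMap ℝ (fun _ : Fin 4 => (Fin (r + 3 + 2) → ℝ)) ℝ}
    {i j : Fin (r + 3)}
    (hW : W ![ofComponents 1 1 0, ofComponents 0 0 (Pi.single i 1), ofComponents 1 1 0,
      ofComponents 0 0 (Pi.single j 1)] ≠ 0)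
    {c : Option (Fin (r + 3)) → ℝ} (hc : c ∉ Set.range (wandParameter W)) :
    ¬ HasWAND (W + typeN 1 (traceFreeFamily c)) := by
  rintro ⟨k, hk, hkk, h⟩
  rcases eq_smul_of_null hkk with hl | ⟨a, ha, v, rfl⟩
  · have h0 := time_component_ne_zero hk hkk
    rw [hl] at h
    have ho : ∀ i, eta (k 0 • ofComponents 1 1 0)
        (ofComponents 0 0 (Pi.single (M := fun _ => ℝ) i 1) : Fin (r + 3 + 2) → ℝ) = 0 :=
      fun i => by simp [eta_eq]
    have := h _ _ (ho i) (ho j)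
    rw [apply_smul_smul, add_apply, typeN_null] at this
    simp [h0] at this
    exact hW this
  · refine hc ⟨v, funext fun p => ?_⟩
    have ho : ∀ i, eta (a • paraboloid v) (screenVector v i) = 0 := fun i => by
      rw [eta_smul_left, eta_paraboloid_screenVector, mul_zero]
    have := h _ _ (ho (entryPosition p).1) (ho (entryPosition p).2)
    rw [apply_smul_smul, add_apply, typeN_paraboloid,
      traceFreeFamily_entryPosition] at this
    have := (mul_eq_zero.1 this).resolve_left (mul_ne_zero ha ha)
    unfold wandParameter
    linarith

/-- Weyl tensors for which `(1, 1, 0)` is visibly not a WAND are limits of Weyl tensors without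
WANDs. -/
lemma mem_closure_of_apply_ne_zero {r : ℕ}
    (W : {W : ContinuousMultilinearMap ℝ (fun _ : Fin 4 => (Fin (r + 3 + 2) → ℝ)) ℝ // IsWeylC W})
    {i j : Fin (r + 3)}
    (hW : W.1 ![ofComponents 1 1 0, ofComponents 0 0 (Pi.single i 1), ofComponents 1 1 0,
      ofComponents 0 0 (Pi.single j 1)] ≠ 0) :
    W ∈ closure {W : {W : ContinuousMultilinearMap ℝ
      (fun _ : Fin 4 => (Fin (r + 3 + 2) → ℝ)) ℝ // IsWeylC W} | ¬ HasWAND W.val} := by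
  let f : (Option (Fin (r + 3)) → ℝ) → {W : ContinuousMultilinearMap ℝ
      (fun _ : Fin 4 => (Fin (r + 3 + 2) → ℝ)) ℝ // IsWeylC W} := fun c =>
    ⟨W.1 + typeN 1 (traceFreeFamily c), isWeylC_add W.2
      (isWeylC_typeN (by norm_num) (traceFreeFamily_comm c) (sum_traceFreeFamily c))⟩
  have hf : Continuous f := Continuous.subtype_mk
    (continuous_const.add ((continuous_typeN 1).comp continuous_traceFreeFamily)) _
  have h0 : f 0 = W := Subtype.ext (by simp [f, traceFreeFamily_zero, typeN])
  rw [← h0]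
  exact map_mem_closure hf (dense_compl_range_wandParameter W.1 0)
    fun c hc => not_hasWAND_add_typeN hW hc

lemma dense_setOf_not_hasWAND (r : ℕ) :
    Dense {W : {W : ContinuousMultilinearMap ℝ (fun _ : Fin 4 => (Fin (r + 3 + 2) → ℝ)) ℝ //
      IsWeylC W} | ¬ HasWAND W.val} := by
  intro W
  rw [← closure_closure]
  let C (t : ℝ) : Option (Fin (r + 3)) → ℝ := Pi.single none t
  let f : ℝ → {W : ContinuousMultilinearMap ℝ
      (fun _ : Fin 4 => (Fin (r + 3 + 2) → ℝ)) ℝ // IsWeylC W} := fun t =>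
    ⟨W.1 + typeN (-1) (traceFreeFamily (C t)), isWeylC_add W.2
      (isWeylC_typeN (by norm_num) (traceFreeFamily_comm _) (sum_traceFreeFamily _))⟩
  have hC : Continuous C :=
    continuous_single (A := fun _ : Option (Fin (r + 3)) => ℝ) none
  have hf : Continuous f := Continuous.subtype_mk
    (continuous_const.add ((continuous_typeN (-1)).comp (continuous_traceFreeFamily.comp hC))) _
  have h0 : f 0 = W := Subtype.ext (by simp [f, C, traceFreeFamily_zero, typeN])
  rw [← h0]
  set w := W.1 ![ofComponents 1 1 0, ofComponents 0 0 (Pi.single 1 1), ofComponents 1 1 0,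
    ofComponents 0 0 (Pi.single 2 1)] with hw
  refine map_mem_closure hf (dense_compl_singleton (-w / 4) 0) fun t ht => ?_
  refine mem_closure_of_apply_ne_zero (f t) (i := 1) (j := 2) ?_
  have hp := traceFreeFamily_entryPosition (C t) none
  simp only [entryPosition, C, Pi.single_eq_same] at hp
  simp only [f, C, add_apply, typeN_null, hp, ← hw]
  intro h
  apply ht
  rw [Set.mem_singleton_iff]
  linarith

/-- For `N ≥ 5`, the set of Weyl tensors on `ℝ^N` possessing no WAND
(alignment type **G**) is a dense open subset of the space of all Weyl tensors on
`ℝ^N`; equivalently, the set of Weyl tensors possessing a WAND is closed with empty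
interior. -/
theorem stmt_12 (N : ℕ) (hN : 5 ≤ N) :
    IsOpen {W : {W : ContinuousMultilinearMap ℝ (fun _ : Fin 4 => (Fin N → ℝ)) ℝ //
        IsWeylC W} | ¬ HasWAND W.val} ∧
    Dense {W : {W : ContinuousMultilinearMap ℝ (fun _ : Fin 4 => (Fin N → ℝ)) ℝ //
        IsWeylC W} | ¬ HasWAND W.val} := by
  obtain ⟨r, rfl⟩ : ∃ r, N = r + 3 + 2 := ⟨N - 5, by omega⟩
  exact ⟨(isClosed_setOf_hasWAND (r + 3)).isOpen_compl.preimage continuous_subtype_val,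
    dense_setOf_not_hasWAND r⟩
end
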